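/- Let K be an algebraically closed field of characteristic 2. Then the polynomial X^{q_0}(X^q + X) + Y^q + Y = X^{q_0+q} + X^{q_0+1} + Y^q + Y, viewed as an element of the polynomial ring K[X,Y] in two variables, is irreducible. -/

import Mathlib

open Polynomial

lemma aux_S_sq {R : Type*} [CommRing R] [CharP R 2] (s : ℕ) (z : R) :
    (∑ i ∈ Finset.range s, z ^ 2 ^ i) ^ 2 + ∑ i ∈ Finset.range s, z ^ 2 ^ i = z ^ 2 ^ s + z := by
  induction s with
  | zero => simp [CharTwo.add_self_eq_zero]
  | succ n ih =>
    rw [Finset.sum_range_succ, CharTwo.add_sq]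
    have h2 : (z ^ 2 ^ n) ^ 2 = z ^ 2 ^ (n+1) := by rw [← pow_mul, pow_succ]
    have h0 := CharTwo.add_self_eq_zero (z ^ 2 ^ n)
    rw [h2]
    linear_combination ih + h0

lemma aux_S_add {R : Type*} [CommRing R] [CharP R 2] (s : ℕ) (z w : R) :
    (∑ i ∈ Finset.range s, (z + w) ^ 2 ^ i) =
      (∑ i ∈ Finset.range s, z ^ 2 ^ i) + ∑ i ∈ Finset.range s, w ^ 2 ^ i := by
  rw [← Finset.sum_add_distrib]
  refine Finset.sum_congr rfl fun i _ => ?_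
  have : Fact (Nat.Prime 2) := ⟨Nat.prime_two⟩
  exact add_pow_char_pow z w 2 i

lemma aux_coeff {K : Type*} [Field K] [CharP K 2] (s h : ℕ) (hh : 0 < h) (hs : 2 * h < s)
    (a : K) (ha : a ≠ 0) (t : K[X])
    (ht : t ^ 2 + t = C a * (X ^ 2 ^ h * (X ^ 2 ^ s + X))) : False := by
  have : Fact (Nat.Prime 2) := ⟨Nat.prime_two⟩
  set n := 2 ^ (s - h) + 1 with hn
  have hfr : t ^ 2 = expand K 2 (t.map (frobenius K 2)) := by
    rw [← map_frobenius_expand, ← map_expand]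
  have hc : ∀ m, (t ^ 2 + t).coeff (m * 2) = t.coeff m ^ 2 + t.coeff (m*2) := by
    intro m
    rw [hfr, coeff_add, coeff_expand_mul (by norm_num), coeff_map, frobenius_def]
  have hodd : ∀ m, ¬ 2 ∣ m → (t ^ 2 + t).coeff m = t.coeff m := by
    intro m hm
    rw [hfr, coeff_add, coeff_expand (by norm_num), if_neg hm, zero_add]
  have hr : ∀ m, (C a * (X ^ 2 ^ h * (X ^ 2 ^ s + X)) : K[X]).coeff m =
      a * ((if m = 2 ^ h + 2 ^ s then 1 else 0) + (if m = 2 ^ h + 1 then 1 else 0)) := by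
    intro m
    rw [mul_add, ← pow_add, ← pow_succ, coeff_C_mul, coeff_add, coeff_X_pow, coeff_X_pow]
  have hnpos : 0 < n := Nat.succ_pos _
  have hlt : 2 ^ h < 2 ^ (s - h) := Nat.pow_lt_pow_right (by norm_num) (by omega)
  have hsplit : 2 ^ s = 2 ^ h * 2 ^ (s - h) := by rw [← pow_add]; congr 1; omega
  have hne1 : ∀ j, n * 2 ^ j ≠ 2 ^ h + 1 := by
    intro j hj
    have := Nat.one_le_two_pow (n := j)
    nlinarith
  have hne2 : ∀ j, n * 2 ^ j = 2 ^ h + 2 ^ s ↔ j = h := by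
    intro j
    have : 2 ^ h + 2 ^ s = n * 2 ^ h := by rw [hsplit, hn]; ring
    rw [this]
    constructor
    · intro e
      exact Nat.pow_right_injective le_rfl (Nat.eq_of_mul_eq_mul_left hnpos e)
    · rintro rfl; rfl
  have step : ∀ j, t.coeff (n * 2 ^ j) ^ 2 + t.coeff (n * 2 ^ (j+1)) =
      a * (if j + 1 = h then 1 else 0) := by
    intro j
    have := hc (n * 2 ^ j)
    rw [ht, mul_assoc, ← pow_succ, hr, if_neg (hne1 _), add_zero] at this
    simp only [hne2] at this
    exact this.symm
  have base : t.coeff n = 0 := by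
    have hnd : ¬ 2 ∣ n := by
      have : 2 ∣ 2 ^ (s - h) := dvd_pow_self 2 (by omega)
      omega
    have := hodd n hnd
    rw [ht, hr] at this
    have e1 := hne1 0
    have e2 := hne2 0
    rw [pow_zero, mul_one] at e1 e2
    rw [if_neg e1, if_neg (by rw [e2]; omega)] at this
    simpa using this.symm
  have low : ∀ j, j < h → t.coeff (n * 2 ^ j) = 0 := by
    intro j
    induction j with
    | zero => intro _; simpa using base
    | succ j ih =>
      intro hj
      have := step j
      rw [ih (by omega), if_neg (by omega)] at this
      simpa using this
  have high : ∀ j, t.coeff (n * 2 ^ (h + j)) ≠ 0 := by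
    intro j
    induction j with
    | zero =>
      have := step (h - 1)
      rw [low _ (by omega), Nat.sub_add_cancel hh, if_pos rfl] at this
      rw [add_zero]
      intro h0
      rw [h0] at this
      simp at this
      exact ha this.symm
    | succ j ih =>
      have := step (h + j)
      rw [if_neg (by omega)] at this
      intro h0
      rw [← add_assoc] at h0
      rw [h0] at this
      simp at this
      exact ih this
  apply high t.natDegree
  apply coeff_eq_zero_of_natDegree_lt
  have h1 : t.natDegree < 2 ^ t.natDegree := Nat.lt_two_pow_self
  have h2 : 2 ^ t.natDegree ≤ 2 ^ (h + t.natDegree) := Nat.pow_le_pow_right (by norm_num) (by omega)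
  exact lt_of_lt_of_le h1 (h2.trans (Nat.le_mul_of_pos_left _ hnpos))

lemma aux_trace (s : ℕ) (hs : s ≠ 0) (H : AddSubgroup (GaloisField 2 s)) (hH : H ≠ ⊤) :
    ∃ a : GaloisField 2 s, a ≠ 0 ∧ ∀ b ∈ H, ∑ i ∈ Finset.range s, (a * b) ^ 2 ^ i = 0 := by
  have hlt : AddSubgroup.toZModSubmodule 2 H < ⊤ := by
    rw [lt_top_iff_ne_top]
    intro h
    apply hH
    rw [eq_top_iff]
    intro x _
    have : x ∈ AddSubgroup.toZModSubmodule 2 H := by rw [h]; trivial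
    exact this
  obtain ⟨φ, hφ, hker⟩ := Submodule.exists_le_ker_of_lt_top _ hlt
  have nd := traceForm_nondegenerate (ZMod 2) (GaloisField 2 s)
  set e := (Algebra.traceForm (ZMod 2) (GaloisField 2 s)).toDual nd with he
  refine ⟨e.symm φ, by simpa using hφ, fun b hb => ?_⟩
  have h1 : φ b = 0 := hker hb
  have h2 : e (e.symm φ) b = φ b := by rw [LinearEquiv.apply_symm_apply]
  rw [he, LinearMap.BilinForm.toDual_def, ← he, Algebra.traceForm_apply, h1] at h2
  have h3 := FiniteField.algebraMap_trace_eq_sum_pow (ZMod 2) (GaloisField 2 s) (e.symm φ * b)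
  rw [h2, GaloisField.finrank 2 hs, Nat.card_zmod, map_zero] at h3
  exact h3.symm

lemma aux_deg {R : Type*} [CommRing R] [Nontrivial R] (n : ℕ) (hn : 1 < n) (f : R) :
    (X ^ n + X + C f : R[X]).Monic ∧ (X ^ n + X + C f : R[X]).natDegree = n := by
  have hd : (X + C f : R[X]).degree < n := by
    rw [degree_X_add_C]; exact_mod_cast hn
  rw [add_assoc]
  refine ⟨monic_X_pow_add hd, ?_⟩
  rw [natDegree_add_eq_left_of_degree_lt (by rwa [degree_X_pow]), natDegree_X_pow]

lemma aux_core (s : ℕ) (hs : s ≠ 0) {k : Type*} [Field k] [CharP k 2]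
    (ι : GaloisField 2 s →+* k) (f : k)
    (hf : ∀ a : GaloisField 2 s, a ≠ 0 → ∀ t : k, t ^ 2 + t ≠ ι a * f) :
    Irreducible (X ^ 2 ^ s + X + C f : k[X]) := by
  have : Fact (Nat.Prime 2) := ⟨Nat.prime_two⟩
  set G : k[X] := X ^ 2 ^ s + X + C f with hG
  have hq1 : 1 < 2 ^ s := Nat.one_lt_two_pow hs
  have hdeg : G.natDegree = 2 ^ s := (aux_deg _ hq1 f).2
  have hmon : G.Monic := (aux_deg _ hq1 f).1
  have hder : derivative G = 1 := by
    have h2 : (2 : k) = 0 := CharTwo.two_eq_zero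
    simp [hG, derivative_X_pow, h2, hs]
  have hsep : G.Separable := by
    rw [separable_def, hder]; exact isCoprime_one_right
  let L := G.SplittingField
  have : IsGalois k L := IsGalois.of_separable_splitting_field hsep
  have : CharP L 2 := charP_of_injective_algebraMap (algebraMap k L).injective 2
  obtain ⟨y, hy⟩ : ∃ y : L, eval₂ (algebraMap k L) y G = 0 := by
    have h := SplittingField.splits G
    obtain ⟨y, hy⟩ := h.exists_eval_eq_zero (by
      rw [degree_map, degree_eq_natDegree hmon.ne_zero, hdeg]
      exact_mod_cast (by omega))
    exact ⟨y, by rwa [eval_map] at hy⟩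
  have hyq : y ^ 2 ^ s + y = algebraMap k L f := by
    have hy := hy
    simp only [G, eval₂_add, eval₂_pow, eval₂_X, eval₂_C] at hy
    exact CharTwo.add_eq_zero.mp hy
  set j : GaloisField 2 s →+* L := (algebraMap k L).comp ι with hj
  have hσj : ∀ (σ : L ≃ₐ[k] L) b, σ (j b) = j b := fun σ b => by simp [hj]
  have hsurj : ∀ c : L, c ^ 2 ^ s = c → ∃ b, j b = c := by
    intro c hc
    by_contra hno
    have := Fintype.ofFinite (GaloisField 2 s)
    classical
    let R : Finset L := insert c (Finset.univ.image j)
    have hcard : R.card = 2 ^ s + 1 := by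
      rw [Finset.card_insert_of_notMem (by simpa using hno),
        Finset.card_image_of_injective _ j.injective, Finset.card_univ,
        ← Nat.card_eq_fintype_card, GaloisField.card 2 s hs]
    have hp0 := FiniteField.X_pow_card_sub_X_ne_zero L hq1
    have hp := FiniteField.X_pow_card_sub_X_natDegree_eq L hq1
    have hle : R.card ≤ (X ^ 2 ^ s - X : L[X]).natDegree := by
      apply card_le_degree_of_subset_roots
      intro x hx
      have hx' : x ∈ R := hx
      rw [mem_roots hp0, IsRoot, eval_sub, eval_pow, eval_X, sub_eq_zero]
      rcases Finset.mem_insert.mp hx' with rfl | hx'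
      · exact hc
      · obtain ⟨b, -, rfl⟩ := Finset.mem_image.mp hx'
        have h := FiniteField.pow_card b
        rw [← Nat.card_eq_fintype_card, GaloisField.card 2 s hs] at h
        rw [← map_pow, h]
    omega
  let H : AddSubgroup (GaloisField 2 s) :=
    { carrier := {b | ∃ σ : L ≃ₐ[k] L, σ y = y + j b}
      zero_mem' := ⟨AlgEquiv.refl, by simp⟩
      add_mem' := by
        rintro a b ⟨σ, hσ⟩ ⟨τ, hτ⟩
        exact ⟨τ.trans σ, by simp only [AlgEquiv.trans_apply, hτ, map_add, hσ, hσj]; ring⟩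
      neg_mem' := by
        rintro a ⟨σ, hσ⟩
        exact ⟨σ, by rw [hσ, CharTwo.neg_eq]⟩ }
  have hroot : ∀ σ : L ≃ₐ[k] L, ∃ b, σ y = y + j b := by
    intro σ
    have h1 : (σ y) ^ 2 ^ s + σ y = algebraMap k L f := by
      rw [← map_pow, ← map_add, hyq, AlgEquiv.commutes]
    obtain ⟨b, hb⟩ := hsurj (σ y + y) (by
      rw [add_pow_char_pow]
      have h0 := CharTwo.add_self_eq_zero (σ y)
      have h0' := CharTwo.add_self_eq_zero y
      linear_combination h1 + hyq - h0 - h0' + CharTwo.add_self_eq_zero (algebraMap k L f))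
    exact ⟨b, by rw [hb]; linear_combination - CharTwo.add_self_eq_zero y⟩
  have hHtop : H = ⊤ := by
    by_contra hne
    obtain ⟨a, ha, hab⟩ := aux_trace s hs H hne
    set T : L := ∑ i ∈ Finset.range s, (j a * y) ^ 2 ^ i with hT
    have hfix : ∀ σ : L ≃ₐ[k] L, σ T = T := by
      intro σ
      obtain ⟨b, hb⟩ := hroot σ
      have hbH : b ∈ H := ⟨σ, hb⟩
      rw [hT, map_sum]
      simp only [map_pow, map_mul, hσj, hb, mul_add]
      rw [aux_S_add]
      have := congrArg j (hab b hbH)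
      simp only [map_sum, map_pow, map_mul, map_zero] at this
      rw [this, add_zero]
    obtain ⟨t, ht⟩ := (IsGalois.mem_range_algebraMap_iff_fixed T).mpr hfix
    apply hf a ha t
    apply (algebraMap k L).injective
    have haq : a ^ 2 ^ s = a := by
      have := Fintype.ofFinite (GaloisField 2 s)
      have h := FiniteField.pow_card a
      rwa [← Nat.card_eq_fintype_card, GaloisField.card 2 s hs] at h
    have haj : j a ^ 2 ^ s = j a := by rw [← map_pow, haq]
    rw [map_add, map_pow, ht, hT, aux_S_sq, mul_pow, haj, map_mul, ← hyq]
    simp only [hj, RingHom.comp_apply]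
    ring
  have hint : IsIntegral k y := ⟨G, hmon, hy⟩
  have hdvd : minpoly k y ∣ G := minpoly.dvd k y hy
  have hle : G.natDegree ≤ (minpoly k y).natDegree := by
    rw [hdeg, ← GaloisField.card 2 s hs]
    have := Fintype.ofFinite (GaloisField 2 s)
    classical
    let R : Finset L := Finset.univ.image (fun b => y + j b)
    have hcard : R.card = Nat.card (GaloisField 2 s) := by
      rw [Finset.card_image_of_injective, Finset.card_univ, Nat.card_eq_fintype_card]
      intro b c hbc
      exact j.injective (add_left_cancel hbc)
    rw [← hcard, ← natDegree_map (algebraMap k L)]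
    apply card_le_degree_of_subset_roots
    intro x hx
    have hx' : x ∈ R := hx
    obtain ⟨b, -, rfl⟩ := Finset.mem_image.mp hx'
    have hb : b ∈ H := by rw [hHtop]; trivial
    obtain ⟨σ, hσ⟩ := hb
    rw [mem_roots (Polynomial.map_ne_zero (minpoly.ne_zero hint)), IsRoot, eval_map_algebraMap]
    simp only [← hσ]
    have h := aeval_algHom_apply (σ : L →ₐ[k] L) y (minpoly k y)
    rw [minpoly.aeval, map_zero] at h
    exact h
  rw [eq_of_monic_of_dvd_of_natDegree_le (minpoly.monic hint) hmon hdvd hle]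
  exact minpoly.irreducible hint

lemma aux_poly (s h : ℕ) (hh : 0 < h) (hs : 2 * h < s)
    (K : Type*) [Field K] [IsAlgClosed K] [CharP K 2] :
    Irreducible (X ^ 2 ^ s + X + C (X ^ 2 ^ h * (X ^ 2 ^ s + X)) : K[X][X]) := by
  have : Fact (Nat.Prime 2) := ⟨Nat.prime_two⟩
  have hs0 : s ≠ 0 := by omega
  have hq1 : 1 < 2 ^ s := Nat.one_lt_two_pow hs0
  have hmon : (X ^ 2 ^ s + X + C (X ^ 2 ^ h * (X ^ 2 ^ s + X)) : K[X][X]).Monic :=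
    (aux_deg _ hq1 _).1
  let k := FractionRing K[X]
  refine Monic.irreducible_of_irreducible_map (algebraMap K[X] k) _ hmon ?_
  let : Algebra (ZMod 2) K := ZMod.algebra K 2
  let ι₀ : GaloisField 2 s →ₐ[ZMod 2] K := IsAlgClosed.lift
  have : CharP k 2 := charP_of_injective_algebraMap (IsFractionRing.injective K[X] k) 2
  let ι : GaloisField 2 s →+* k := ((algebraMap K[X] k).comp C).comp (ι₀ : GaloisField 2 s →+* K)
  have := aux_core s hs0 ι (algebraMap K[X] k (X ^ 2 ^ h * (X ^ 2 ^ s + X))) ?_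
  · simpa only [Polynomial.map_add, Polynomial.map_pow, map_X, map_C] using this
  · intro a ha t ht
    have hι : ι a = algebraMap K[X] k (C (ι₀ a)) := rfl
    rw [hι, ← map_mul] at ht
    have hint : IsIntegral K[X] t := by
      refine ⟨X ^ 2 + X - C (C (ι₀ a) * (X ^ 2 ^ h * (X ^ 2 ^ s + X))), by monicity!, ?_⟩
      simp only [eval₂_sub, eval₂_add, eval₂_pow, eval₂_X, eval₂_C]
      rw [ht, sub_self]
    obtain ⟨u, rfl⟩ := IsIntegrallyClosed.isIntegral_iff.mp hint
    rw [← map_pow, ← map_add] at ht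
    exact aux_coeff s h hh hs (ι₀ a) (by simpa using ha) u (IsFractionRing.injective K[X] k ht)

/-- over an algebraically closed field `K` of characteristic 2, the
polynomial `X^{q_0}(X^q + X) + Y^q + Y ∈ K[X,Y]` is irreducible. -/
theorem stmt_6 (s h q q0 : ℕ) (hh : 0 < h) (hs : 2 * h < s)
    (hq : q = 2 ^ s) (hq0 : q0 = 2 ^ h)
    (K : Type*) [Field K] [IsAlgClosed K] [CharP K 2] :
    Irreducible
      (MvPolynomial.X 0 ^ q0 * (MvPolynomial.X 0 ^ q + MvPolynomial.X 0)
        + MvPolynomial.X 1 ^ q + MvPolynomial.X 1 : MvPolynomial (Fin 2) K) := by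
  subst hq hq0
  let e : MvPolynomial (Fin 2) K ≃ₐ[K] K[X][X] :=
    ((MvPolynomial.renameEquiv K (Equiv.swap (0 : Fin 2) 1)).trans
      (MvPolynomial.finSuccEquiv K 1)).trans
      (Polynomial.mapAlgEquiv (MvPolynomial.uniqueAlgEquiv K (Fin 1)))
  have e0 : e (MvPolynomial.X 0) = C X := by
    have h1 : (1 : Fin 2) = Fin.succ 0 := rfl
    simp only [e, AlgEquiv.trans_apply, MvPolynomial.renameEquiv_apply, MvPolynomial.rename_X,
      Equiv.swap_apply_left]
    rw [h1, MvPolynomial.finSuccEquiv_X_succ]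
    simp
  have e1 : e (MvPolynomial.X 1) = X := by
    simp only [e, AlgEquiv.trans_apply, MvPolynomial.renameEquiv_apply, MvPolynomial.rename_X,
      Equiv.swap_apply_right]
    rw [MvPolynomial.finSuccEquiv_X_zero]
    simp
  rw [← MulEquiv.irreducible_iff e]
  simp only [map_add, map_mul, map_pow, e0, e1]
  have := aux_poly s h hh hs K
  simp only [map_add, map_mul, map_pow] at this
  convert this using 1
  ring
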